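/- arXiv:2209.04474 — 3 statements merged into one kernel-verified Lean document; each statement's English description precedes it below -/
import Mathlib

section
/- For every effect vector e there exists a vector e' ∈ ℝ^(X × A) with all entries non-negative such that ⟨e', P⟩ = ⟨e, P⟩ for every P ∈ S_NS; that is, every effect can be represented by a vector in which every entry is non-negative. -/
open Finset

/-- The standard inner product on `ℝ^(X × A)`. -/
def ip {N nI nO : ℕ} (e P : (Fin N → Fin nI) → (Fin N → Fin nO) → ℝ) : ℝ :=
  ∑ x : Fin N → Fin nI, ∑ a : Fin N → Fin nO, e x a * P x a

/-- The single-party no-signalling conditions. -/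
def NoSig (N nI nO : ℕ) (P : (Fin N → Fin nI) → (Fin N → Fin nO) → ℝ) : Prop :=
  ∀ i : Fin N, ∀ x x' : Fin N → Fin nI, (∀ j, j ≠ i → x j = x' j) →
    ∀ a : Fin N → Fin nO,
      ∑ b : Fin nO, P x (Function.update a i b) =
      ∑ b : Fin nO, P x' (Function.update a i b)

/-- The state space of no-signalling behaviours. -/
def SNS (N nI nO : ℕ) (P : (Fin N → Fin nI) → (Fin N → Fin nO) → ℝ) : Prop :=
  NoSig N nI nO P ∧ (∀ x a, 0 ≤ P x a) ∧
    (∀ x : Fin N → Fin nI, ∑ a : Fin N → Fin nO, P x a = 1)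

/-- Effect vectors: `0 ≤ ⟨e, P⟩ ≤ 1` on all no-signalling states. -/
def IsEffect (N nI nO : ℕ) (e : (Fin N → Fin nI) → (Fin N → Fin nO) → ℝ) : Prop :=
  ∀ P, SNS N nI nO P → 0 ≤ ip e P ∧ ip e P ≤ 1

/-- Extremal effect vectors. -/
def IsExtremalEffect (N nI nO : ℕ) (e : (Fin N → Fin nI) → (Fin N → Fin nO) → ℝ) : Prop :=
  IsEffect N nI nO e ∧
  ∀ e₁ e₂ : (Fin N → Fin nI) → (Fin N → Fin nO) → ℝ, ∀ α : ℝ,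
    IsEffect N nI nO e₁ → IsEffect N nI nO e₂ → 0 < α → α < 1 →
    (∀ P, SNS N nI nO P → ip e P = α * ip e₁ P + (1 - α) * ip e₂ P) →
    (∀ P, SNS N nI nO P → ip e₁ P = ip e P ∧ ip e₂ P = ip e P)

/-- Overwriting one coordinate by every possible value counts each function `card B` times. -/
theorem sum_sum_update {ι B : Type*} [Fintype ι] [DecidableEq ι] [Fintype B]
    (f : (ι → B) → ℝ) (i : ι) :
    ∑ a : ι → B, ∑ b : B, f (Function.update a i b) = Fintype.card B * ∑ a : ι → B, f a := by
  have hinv : Function.Involutive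
      (fun p : (ι → B) × B => (Function.update p.1 i p.2, p.1 i)) := by
    rintro ⟨a, b⟩
    simp
  calc ∑ a : ι → B, ∑ b : B, f (Function.update a i b)
      = ∑ p : (ι → B) × B, f (hinv.toPerm _ p).1 := by
        simp [Fintype.sum_prod_type]
    _ = ∑ p : (ι → B) × B, f p.1 := Equiv.sum_comp (hinv.toPerm _) fun p => f p.1
    _ = Fintype.card B * ∑ a : ι → B, f a := by
        simp [Fintype.sum_prod_type, Finset.mul_sum]

/-- The total weight of a no-signalling vector does not depend on the input tuple. -/
theorem NoSig.sum_eq {N nI nO : ℕ} (hO : 0 < nO)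
    {P : (Fin N → Fin nI) → (Fin N → Fin nO) → ℝ} (hP : NoSig N nI nO P)
    (x x' : Fin N → Fin nI) : ∑ a, P x a = ∑ a, P x' a := by
  have step (i : Fin N) (x x' : Fin N → Fin nI) (h : ∀ j, j ≠ i → x j = x' j) :
      ∑ a, P x a = ∑ a, P x' a := by
    have hsum := Finset.sum_congr rfl fun a (_ : a ∈ Finset.univ) => hP i x x' h a
    rw [sum_sum_update, sum_sum_update, Fintype.card_fin] at hsum
    exact mul_left_cancel₀ (by positivity) hsum
  suffices H : ∀ s : Finset (Fin N), ∀ x : Fin N → Fin nI, (∀ j, j ∉ s → x j = x' j) →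
      ∑ a, P x a = ∑ a, P x' a from H Finset.univ x (by simp)
  intro s
  induction s using Finset.induction_on with
  | empty =>
    intro x h
    rw [funext fun j => h j (by simp)]
  | insert i s _ ih =>
    intro x h
    rw [step i x (Function.update x i (x' i)) fun j hj => by simp [hj]]
    refine ih _ fun j hj => ?_
    by_cases hji : j = i
    · subst hji
      simp
    · simp [hji, h j (by simp [hji, hj])]

/-- The subspace of no-signalling vectors. -/
def noSigSubmodule (N nI nO : ℕ) :
    Submodule ℝ ((Fin N → Fin nI) → (Fin N → Fin nO) → ℝ) where
  carrier := {P | NoSig N nI nO P}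
  zero_mem' := by simp [NoSig]
  add_mem' := fun hP hQ i x x' h a => by
    simp [Finset.sum_add_distrib, hP i x x' h a, hQ i x x' h a]
  smul_mem' := fun c P hP i x x' h a => by
    simp [← Finset.mul_sum, hP i x x' h a]

/-- Pairing with a fixed vector, as a linear functional. -/
def ipLinear {N nI nO : ℕ} (e : (Fin N → Fin nI) → (Fin N → Fin nO) → ℝ) :
    ((Fin N → Fin nI) → (Fin N → Fin nO) → ℝ) →ₗ[ℝ] ℝ where
  toFun := ip e
  map_add' P Q := by simp [ip, mul_add, Finset.sum_add_distrib]
  map_smul' c P := by simp [ip, Finset.mul_sum, mul_left_comm]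

/-- An effect is non-negative on unnormalised no-signalling behaviours. -/
theorem IsEffect.ip_nonneg {N nI nO : ℕ} (hI : 0 < nI) (hO : 0 < nO)
    {e P : (Fin N → Fin nI) → (Fin N → Fin nO) → ℝ} (he : IsEffect N nI nO e)
    (hP : NoSig N nI nO P) (hpos : ∀ x a, 0 ≤ P x a) : 0 ≤ ip e P := by
  have hsum (x) := hP.sum_eq hO x fun _ => ⟨0, hI⟩
  set T := ∑ a, P (fun _ => ⟨0, hI⟩) a
  have hT : 0 ≤ T := Finset.sum_nonneg fun a _ => hpos _ a
  obtain hT | hT := hT.eq_or_lt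
  · have hzero (x a) : P x a = 0 :=
      (Finset.sum_eq_zero_iff_of_nonneg fun a _ => hpos x a).1 ((hsum x).trans hT.symm) a
        (Finset.mem_univ a)
    simp [ip, hzero]
  · have hS : SNS N nI nO (T⁻¹ • P) := by
      refine ⟨(noSigSubmodule N nI nO).smul_mem _ hP, fun x a => ?_, fun x => ?_⟩
      · exact mul_nonneg (inv_nonneg.2 hT.le) (hpos x a)
      · simp [← Finset.mul_sum, hsum x, hT.ne']
    have h : 0 ≤ T⁻¹ * ip e P := (he _ hS).1.trans_eq ((ipLinear e).map_smul T⁻¹ P)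
    exact nonneg_of_mul_nonneg_right h (inv_pos.2 hT)

theorem effect_has_nonneg_representation (N nI nO : ℕ)
    (hN : 0 < N) (hI : 0 < nI) (hO : 0 < nO)
    (e : (Fin N → Fin nI) → (Fin N → Fin nO) → ℝ) (he : IsEffect N nI nO e) :
    ∃ e' : (Fin N → Fin nI) → (Fin N → Fin nO) → ℝ,
      (∀ x a, 0 ≤ e' x a) ∧ (∀ P, SNS N nI nO P → ip e' P = ip e P) := by
  obtain ⟨g, hg, hg_nonneg⟩ := riesz_extension
    (PointedCone.positive ℝ ((Fin N → Fin nI) → (Fin N → Fin nO) → ℝ))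
    ⟨noSigSubmodule N nI nO, (ipLinear e).domRestrict (noSigSubmodule N nI nO)⟩
    (fun P hP => he.ip_nonneg hI hO P.2 hP)
    (fun Q => by
      refine ⟨⟨fun _ _ => ∑ x, ∑ a, |Q x a|, fun _ _ _ _ _ => rfl⟩, fun x a => ?_⟩
      have h₁ : |Q x a| ≤ ∑ a, |Q x a| :=
        Finset.single_le_sum (fun a _ => abs_nonneg (Q x a)) (Finset.mem_univ a)
      have h₂ : ∑ a, |Q x a| ≤ ∑ x, ∑ a, |Q x a| :=
        Finset.single_le_sum (f := fun x => ∑ a, |Q x a|)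
          (fun x _ => Finset.sum_nonneg fun a _ => abs_nonneg (Q x a)) (Finset.mem_univ x)
      have h₃ := neg_abs_le (Q x a)
      change 0 ≤ (∑ x, ∑ a, |Q x a|) + Q x a
      linarith)
  refine ⟨fun x a => g (Pi.single x (Pi.single a 1)), fun x a => hg_nonneg _ ?_, fun P hP => ?_⟩
  · simp
  · have hgP : g P = ip e P := hg ⟨P, hP.1⟩
    have hdecomp : P = ∑ x, ∑ a, P x a • Pi.single x (Pi.single a (1 : ℝ)) := by
      ext x a
      simp [Finset.sum_apply, Pi.single_apply, ite_apply]
    rw [← hgP]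
    conv_rhs => rw [hdecomp]
    simp [ip, mul_comm]
end

section
/- The linear span in ℝ^(X × A) of the set of local deterministic states equals the linear span of the state space S_NS; in particular, every no-signalling state is a linear combination of local deterministic states. -/
open Finset

/-- Local deterministic states. -/
def IsLocalDet (N nI nO : ℕ) (P : (Fin N → Fin nI) → (Fin N → Fin nO) → ℝ) : Prop :=
  ∃ f : Fin N → Fin nI → Fin nO,
    P = fun x a => ∏ i : Fin N, if a i = f i (x i) then (1 : ℝ) else 0

/-- A one-party behaviour with input-independent total weight is an explicit linear combination of
deterministic assignments that differ from a constant one in at most one place. -/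
theorem eq_sum_mul_deterministic {nI nO : ℕ} (g : Fin nI → Fin nO → ℝ)
    (hg : ∀ y y', ∑ b, g y b = ∑ b, g y' b) (z : Fin nO) (x₀ x : Fin nI) (a : Fin nO) :
    g x a = ∑ y, ∑ b, g y b * (if a = Function.update (fun _ => z) y b x then (1 : ℝ) else 0) -
      ∑ b, ((nI : ℝ) - 1) * g x₀ b * (if a = z then (1 : ℝ) else 0) := by
  have inner : ∀ y, ∑ b, g y b *
      (if a = Function.update (fun _ => z) y b x then (1 : ℝ) else 0) =
      (∑ b, g x₀ b) * (if a = z then (1 : ℝ) else 0) +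
        (if y = x then g x a - (∑ b, g x₀ b) * (if a = z then (1 : ℝ) else 0) else 0) := by
    intro y
    by_cases hy : y = x
    · subst hy
      simp
    · have hx : x ≠ y := Ne.symm hy
      simp only [Function.update_of_ne hx, if_neg hy, add_zero]
      rw [← Finset.sum_mul, hg y x₀]
  simp_rw [inner]
  simp_rw [Finset.sum_add_distrib, ← Finset.sum_mul, ← Finset.mul_sum]
  by_cases ha : a = z
  · simp [ha]
    ring
  · simp [ha]

theorem NoSig.fix_coordinate {N nI nO : ℕ} {R : (Fin N → Fin nI) → (Fin N → Fin nO) → ℝ}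
    (hR : NoSig N nI nO R) (i : Fin N) (y : Fin nI) (b : Fin nO) :
    NoSig N nI nO (fun x a => R (Function.update x i y) (Function.update a i b)) := by
  intro j x x' hx a
  by_cases hj : j = i
  · subst hj
    have hxx : Function.update x j y = Function.update x' j y := by
      ext k
      by_cases hk : k = j
      · subst hk; simp
      · simp [Function.update_of_ne hk, hx k hk]
    simp only [hxx]
  · have key := hR j (Function.update x i y) (Function.update x' i y) (by
      intro k hk
      by_cases hki : k = i
      · subst hki; simp
      · simp [Function.update_of_ne hki, hx k hk]) (Function.update a i b)
    simpa only [Function.update_comm hj] using key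

/-- A no-signalling vector that depends only on the parties in `S`, multiplied by deterministic
factors for all other parties, lies in the span of the local deterministic states. -/
theorem NoSig.prod_mul_mem_span_localDet {N nI nO : ℕ} (x₀ : Fin nI) (z : Fin nO)
    (S : Finset (Fin N)) :
    ∀ (f : Fin N → Fin nI → Fin nO) (R : (Fin N → Fin nI) → (Fin N → Fin nO) → ℝ),
      NoSig N nI nO R →
      (∀ x x' a a', (∀ i ∈ S, x i = x' i ∧ a i = a' i) → R x a = R x' a') →
      (fun x a => (∏ i ∈ Sᶜ, if a i = f i (x i) then (1 : ℝ) else 0) * R x a) ∈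
        Submodule.span ℝ {Q | IsLocalDet N nI nO Q} := by
  induction S using Finset.induction_on with
  | empty =>
    intro f R _ hdep
    have heq : (fun x a => (∏ i ∈ (∅ : Finset (Fin N))ᶜ,
        if a i = f i (x i) then (1 : ℝ) else 0) * R x a) =
        R (fun _ => x₀) (fun _ => z) •
          fun (x : Fin N → Fin nI) (a : Fin N → Fin nO) =>
            ∏ i, if a i = f i (x i) then (1 : ℝ) else 0 := by
      ext x a
      rw [hdep x (fun _ => x₀) a (fun _ => z) (by simp)]
      simp only [Finset.compl_empty, Pi.smul_apply, smul_eq_mul]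
      ring
    rw [heq]
    exact Submodule.smul_mem _ _ (Submodule.subset_span ⟨f, rfl⟩)
  | insert i S hi ih =>
    intro f R hR hdep
    have hmem : ∀ (y : Fin nI) (b : Fin nO) (h : Fin nI → Fin nO),
        (fun x a => (∏ j ∈ Sᶜ, if a j = Function.update f i h j (x j) then (1 : ℝ) else 0) *
          R (Function.update x i y) (Function.update a i b)) ∈
          Submodule.span ℝ {Q | IsLocalDet N nI nO Q} := by
      intro y b h
      refine ih (Function.update f i h) _ (hR.fix_coordinate i y b) ?_
      intro x x' a a' hS
      refine hdep _ _ _ _ fun j hj => ?_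
      by_cases hji : j = i
      · subst hji; simp
      · simpa [Function.update_of_ne hji] using hS j (Finset.mem_of_mem_insert_of_ne hj hji)
    have hprod : ∀ (h : Fin nI → Fin nO) (x : Fin N → Fin nI) (a : Fin N → Fin nO),
        (∏ j ∈ Sᶜ, if a j = Function.update f i h j (x j) then (1 : ℝ) else 0) =
          (if a i = h (x i) then (1 : ℝ) else 0) *
            ∏ j ∈ (insert i S)ᶜ, if a j = f j (x j) then (1 : ℝ) else 0 := by
      intro h x a
      rw [Finset.compl_insert, ← Finset.mul_prod_erase Sᶜ _ (Finset.mem_compl.mpr hi)]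
      congr 1
      · simp
      · refine Finset.prod_congr rfl fun j hj => ?_
        rw [Function.update_of_ne (Finset.ne_of_mem_erase hj)]
    have heq : (fun x a => (∏ j ∈ (insert i S)ᶜ,
        if a j = f j (x j) then (1 : ℝ) else 0) * R x a) =
        ∑ y, ∑ b, (fun x a => (∏ j ∈ Sᶜ,
          if a j = Function.update f i (Function.update (fun _ => z) y b) j (x j)
            then (1 : ℝ) else 0) * R (Function.update x i y) (Function.update a i b)) -
        ∑ b, ((nI : ℝ) - 1) • (fun x a => (∏ j ∈ Sᶜ,
          if a j = Function.update f i (fun _ => z) j (x j) then (1 : ℝ) else 0) *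
            R (Function.update x i x₀) (Function.update a i b)) := by
      ext x a
      have key := eq_sum_mul_deterministic
        (fun y b => R (Function.update x i y) (Function.update a i b))
        (fun y y' => hR i _ _ (fun j hj => by simp [Function.update_of_ne hj]) a)
        z x₀ (x i) (a i)
      simp only [Function.update_eq_self] at key
      simp only [Pi.sub_apply, Finset.sum_apply, Pi.smul_apply, smul_eq_mul, hprod]
      rw [key, mul_sub, Finset.mul_sum, Finset.mul_sum]
      simp only [Finset.mul_sum]
      congr 1
      · exact Finset.sum_congr rfl fun y _ => Finset.sum_congr rfl fun b _ => by ring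
      · exact Finset.sum_congr rfl fun b _ => by ring
    rw [heq]
    exact Submodule.sub_mem _
      (Submodule.sum_mem _ fun y _ => Submodule.sum_mem _ fun b _ => hmem y b _)
      (Submodule.sum_mem _ fun b _ => Submodule.smul_mem _ _ (hmem x₀ b _))

theorem NoSig.mem_span_localDet {N nI nO : ℕ} (hI : 0 < nI) (hO : 0 < nO)
    {P : (Fin N → Fin nI) → (Fin N → Fin nO) → ℝ} (hP : NoSig N nI nO P) :
    P ∈ Submodule.span ℝ {Q | IsLocalDet N nI nO Q} := by
  have h := hP.prod_mul_mem_span_localDet ⟨0, hI⟩ ⟨0, hO⟩ Finset.univ (fun _ _ => ⟨0, hO⟩) P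
    (fun x x' a a' h => by
      rw [funext fun i => (h i (Finset.mem_univ i)).1,
        funext fun i => (h i (Finset.mem_univ i)).2])
  simpa using h

theorem IsLocalDet.sns {N nI nO : ℕ} {P : (Fin N → Fin nI) → (Fin N → Fin nO) → ℝ}
    (hP : IsLocalDet N nI nO P) : SNS N nI nO P := by
  obtain ⟨f, rfl⟩ := hP
  refine ⟨?_, fun x a => Finset.prod_nonneg fun i _ => by positivity, fun x => ?_⟩
  · intro i x x' hx a
    have marginal : ∀ w : Fin N → Fin nI,
        ∑ b, ∏ j, (if Function.update a i b j = f j (w j) then (1 : ℝ) else 0) =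
          ∏ j ∈ Finset.univ.erase i, if a j = f j (w j) then (1 : ℝ) else 0 := by
      intro w
      have split : ∀ b, ∏ j, (if Function.update a i b j = f j (w j) then (1 : ℝ) else 0) =
          (if b = f i (w i) then (1 : ℝ) else 0) *
            ∏ j ∈ Finset.univ.erase i, if a j = f j (w j) then (1 : ℝ) else 0 := by
        intro b
        rw [← Finset.mul_prod_erase Finset.univ _ (Finset.mem_univ i)]
        congr 1
        · simp
        · refine Finset.prod_congr rfl fun j hj => ?_
          rw [Function.update_of_ne (Finset.ne_of_mem_erase hj)]
      simp_rw [split, ← Finset.sum_mul]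
      simp
    simp only [marginal]
    exact Finset.prod_congr rfl fun j hj => by rw [hx j (Finset.ne_of_mem_erase hj)]
  · have h := Fintype.prod_sum
      (fun (i : Fin N) (b : Fin nO) => if b = f i (x i) then (1 : ℝ) else 0)
    simpa using h.symm

theorem span_localDet_eq_span_SNS (N nI nO : ℕ)
    (hN : 0 < N) (hI : 0 < nI) (hO : 0 < nO) :
    Submodule.span ℝ {P : (Fin N → Fin nI) → (Fin N → Fin nO) → ℝ | IsLocalDet N nI nO P} =
      Submodule.span ℝ {P : (Fin N → Fin nI) → (Fin N → Fin nO) → ℝ | SNS N nI nO P} ∧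
    ∀ P : (Fin N → Fin nI) → (Fin N → Fin nO) → ℝ, SNS N nI nO P →
      P ∈ Submodule.span ℝ
        {Q : (Fin N → Fin nI) → (Fin N → Fin nO) → ℝ | IsLocalDet N nI nO Q} := by
  have hmem : ∀ P : (Fin N → Fin nI) → (Fin N → Fin nO) → ℝ, SNS N nI nO P →
      P ∈ Submodule.span ℝ {Q | IsLocalDet N nI nO Q} :=
    fun P hP => hP.1.mem_span_localDet hI hO
  exact ⟨le_antisymm (Submodule.span_mono fun P hP => IsLocalDet.sns hP)
    (Submodule.span_le.mpr hmem), hmem⟩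
end

section
/- Let ŝ be the cross-section-III state ŝ = ω·P^NL₁ + (η/2)(P^L₁ + P^L₉) + (1 − ω − η)·P^O, with η, ω ≥ 0 and η + ω ≤ 1. Then: (i) CHSH(ŝ) = 2(1 + ω); and (ii) the distilled bipartite behaviour P' obtained by applying the effects e₀, e₁ (for Alice) and f₀, f₁ (for Bob) to three copies of ŝ satisfies CHSH(P') = (1/32)·[7ω³ + 5η³ + 33ω² + 57ω + η²(13 + 25ω) + 3η(5 + 18ω + 9ω²) + 31]. -/
open Finset

/-- The PR box `P^NL₁(ab|xy) = ½·1[a⊕b = x·y]` (arguments in order a b x y). -/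
noncomputable def PNL1 : Fin 2 → Fin 2 → Fin 2 → Fin 2 → ℝ :=
  fun a b x y => if a + b = x * y then 1 / 2 else 0

/-- The anti-PR box `P^NL₂(ab|xy) = ½·1[a⊕b = x·y ⊕ 1]`. -/
noncomputable def PNL2 : Fin 2 → Fin 2 → Fin 2 → Fin 2 → ℝ :=
  fun a b x y => if a + b = x * y + 1 then 1 / 2 else 0

/-- The local box `P^L₁(ab|xy) = 1[a = 0]·1[b = 0]`. -/
def PL1 : Fin 2 → Fin 2 → Fin 2 → Fin 2 → ℝ :=
  fun a b _ _ => if a = 0 ∧ b = 0 then 1 else 0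

/-- The local box `P^L₆(ab|xy) = 1[a = 1]·1[b = 1]`. -/
def PL6 : Fin 2 → Fin 2 → Fin 2 → Fin 2 → ℝ :=
  fun a b _ _ => if a = 1 ∧ b = 1 then 1 else 0

/-- The local box `P^L₉(ab|xy) = 1[a = x]·1[b = 0]`. -/
def PL9 : Fin 2 → Fin 2 → Fin 2 → Fin 2 → ℝ :=
  fun a b x _ => if a = x ∧ b = 0 then 1 else 0

/-- The local box `P^O = ¾·P^NL₁ + ¼·P^NL₂`. -/
noncomputable def PO : Fin 2 → Fin 2 → Fin 2 → Fin 2 → ℝ :=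
  fun a b x y => 3 / 4 * PNL1 a b x y + 1 / 4 * PNL2 a b x y

/-- The correlator `E_xy(P) = ∑_{a,b} (−1)^(a⊕b) P(ab|xy)`. -/
def Exy (P : Fin 2 → Fin 2 → Fin 2 → Fin 2 → ℝ) (x y : Fin 2) : ℝ :=
  ∑ a : Fin 2, ∑ b : Fin 2, (if a = b then (1 : ℝ) else -1) * P a b x y

/-- The CHSH value of a bipartite behaviour. -/
def CHSH (P : Fin 2 → Fin 2 → Fin 2 → Fin 2 → ℝ) : ℝ :=
  Exy P 0 0 + Exy P 0 1 + Exy P 1 0 - Exy P 1 1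

/-- The contraction of two tripartite vectors against three copies of a
bipartite behaviour. -/
def contra (g h : (Fin 3 → Fin 2) → (Fin 3 → Fin 2) → ℝ)
    (s : Fin 2 → Fin 2 → Fin 2 → Fin 2 → ℝ) : ℝ :=
  ∑ x : Fin 3 → Fin 2, ∑ a : Fin 3 → Fin 2, ∑ y : Fin 3 → Fin 2, ∑ b : Fin 3 → Fin 2,
    g x a * h y b * ∏ i : Fin 3, s (a i) (b i) (x i) (y i)

/-- The indicator vector of a list of (input tuple, output tuple) pairs. -/
def ind (l : List ((Fin 3 → Fin 2) × (Fin 3 → Fin 2))) :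
    (Fin 3 → Fin 2) → (Fin 3 → Fin 2) → ℝ :=
  fun x a => if (x, a) ∈ l then 1 else 0

def eA0 : (Fin 3 → Fin 2) → (Fin 3 → Fin 2) → ℝ :=
  ind [(![0,0,0], ![0,0,0]), (![0,0,0], ![0,1,1]), (![0,0,0], ![1,0,1]), (![0,0,0], ![1,1,0])]
def eA0c : (Fin 3 → Fin 2) → (Fin 3 → Fin 2) → ℝ :=
  ind [(![0,0,0], ![0,0,1]), (![0,0,0], ![0,1,0]), (![0,0,0], ![1,0,0]), (![0,0,0], ![1,1,1])]
def eA1 : (Fin 3 → Fin 2) → (Fin 3 → Fin 2) → ℝ :=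
  ind [(![0,1,1], ![1,1,1]), (![1,0,1], ![1,0,0]), (![1,1,0], ![0,0,1]), (![1,1,1], ![0,1,0])]
def eA1c : (Fin 3 → Fin 2) → (Fin 3 → Fin 2) → ℝ :=
  ind [(![0,1,1], ![0,1,1]), (![1,0,1], ![1,1,0]), (![1,1,0], ![0,0,0]), (![1,1,1], ![1,0,1])]
def fB0 : (Fin 3 → Fin 2) → (Fin 3 → Fin 2) → ℝ := eA1c
def fB0c : (Fin 3 → Fin 2) → (Fin 3 → Fin 2) → ℝ := eA1
def fB1 : (Fin 3 → Fin 2) → (Fin 3 → Fin 2) → ℝ :=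
  ind [(![0,0,0], ![1,0,1]), (![0,0,1], ![0,0,0]), (![0,1,0], ![1,1,0]), (![1,0,0], ![0,1,1])]
def fB1c : (Fin 3 → Fin 2) → (Fin 3 → Fin 2) → ℝ :=
  ind [(![0,0,0], ![0,1,0]), (![0,0,1], ![0,0,1]), (![0,1,0], ![1,0,0]), (![1,0,0], ![1,1,1])]

/-- Alice's tripartite effect for input `x` and outcome `a`. -/
def aliceEff (x a : Fin 2) : (Fin 3 → Fin 2) → (Fin 3 → Fin 2) → ℝ :=
  if x = 0 then (if a = 0 then eA0 else eA0c) else (if a = 0 then eA1 else eA1c)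

/-- Bob's tripartite effect for input `y` and outcome `b`. -/
def bobEff (y b : Fin 2) : (Fin 3 → Fin 2) → (Fin 3 → Fin 2) → ℝ :=
  if y = 0 then (if b = 0 then fB0 else fB0c) else (if b = 0 then fB1 else fB1c)

/-- The distilled bipartite behaviour obtained from three copies of `s`. -/
def distilled (s : Fin 2 → Fin 2 → Fin 2 → Fin 2 → ℝ) :
    Fin 2 → Fin 2 → Fin 2 → Fin 2 → ℝ :=
  fun a b x y => contra (aliceEff x a) (bobEff y b) s

theorem sum_ind_mul (l : List ((Fin 3 → Fin 2) × (Fin 3 → Fin 2))) (hl : l.Nodup)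
    (F : (Fin 3 → Fin 2) → (Fin 3 → Fin 2) → ℝ) :
    ∑ x, ∑ a, ind l x a * F x a = (l.map fun p => F p.1 p.2).sum := by
  rw [← Fintype.sum_prod_type' (fun x a => ind l x a * F x a), ← List.sum_toFinset _ hl]
  simp only [ind, Prod.mk.eta, ite_mul, one_mul, zero_mul, ← Finset.sum_filter]
  congr 1
  ext p
  simp

theorem contra_ind (l m : List ((Fin 3 → Fin 2) × (Fin 3 → Fin 2)))
    (hl : l.Nodup) (hm : m.Nodup) (s : Fin 2 → Fin 2 → Fin 2 → Fin 2 → ℝ) :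
    contra (ind l) (ind m) s =
      (l.map fun p => (m.map fun q =>
        ∏ i : Fin 3, s (p.2 i) (q.2 i) (p.1 i) (q.1 i)).sum).sum := by
  simp only [contra, mul_assoc, ← Finset.mul_sum, sum_ind_mul _ hl, sum_ind_mul _ hm]

theorem distillation_cross_section_III (ω η : ℝ)
    (hω : 0 ≤ ω) (hη : 0 ≤ η) (hsum : η + ω ≤ 1)
    (shat : Fin 2 → Fin 2 → Fin 2 → Fin 2 → ℝ)
    (hshat : shat = fun a b x y =>
      ω * PNL1 a b x y + η / 2 * (PL1 a b x y + PL9 a b x y) +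
        (1 - ω - η) * PO a b x y) :
    CHSH shat = 2 * (1 + ω) ∧
    CHSH (distilled shat) =
      (1 / 32) * (7 * ω ^ 3 + 5 * η ^ 3 + 33 * ω ^ 2 + 57 * ω +
        η ^ 2 * (13 + 25 * ω) + 3 * η * (5 + 18 * ω + 9 * ω ^ 2) + 31) := by
  have hs : ∀ a b x y, shat a b x y =
      ω * PNL1 a b x y + η / 2 * (PL1 a b x y + PL9 a b x y) +
        (1 - ω - η) * PO a b x y := by simp [hshat]
  constructor
  · simp [CHSH, Exy, hs, PNL1, PNL2, PL1, PL9, PO]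
    ring
  · simp only [CHSH, Exy, distilled, aliceEff, bobEff, Fin.sum_univ_two, Fin.isValue,
      if_true, one_ne_zero, zero_ne_one, if_false, eA0, eA0c, eA1, eA1c, fB0, fB0c, fB1, fB1c]
    repeat rw [contra_ind _ _ (by decide) (by decide)]
    have values : ∀ a b x y, shat a b x y =
        (if a + b = x * y then (3 + ω - 3 * η) / 8 else (1 - ω - η) / 8) +
          if b = 0 then (if a = 0 then η / 2 else 0) + (if a = x then η / 2 else 0)
          else 0 := by
      intro a b x y
      rw [hs]
      fin_cases a <;> fin_cases b <;> fin_cases x <;> fin_cases y <;>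
        simp [PNL1, PNL2, PL1, PL9, PO] <;> ring
    simp [Fin.prod_univ_three, values]
    ring
end
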